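/- Let G be a finite group, let B be a non-splitting Rota–Baxter operator on G, and set R = Im(B) ∩ Im(B̃). Then R is not contained in ker(B), or R is not contained in ker(B̃). -/

import Mathlib

/-- A Rota–Baxter operator of weight 1 on a group. -/
def IsRotaBaxter {G : Type*} [Group G] (B : G → G) : Prop :=
  ∀ g h : G, B g * B h = B (g * B g * h * (B g)⁻¹)

/-- A splitting Rota–Baxter operator: comes from an exact factorization G = HL. -/
def IsSplitting {G : Type*} [Group G] (B : G → G) : Prop :=
  ∃ H L : Subgroup G, H ⊓ L = ⊥ ∧ (∀ g : G, ∃ h ∈ H, ∃ l ∈ L, g = h * l) ∧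
    (∀ h ∈ H, ∀ l ∈ L, B (h * l) = l⁻¹)

/-- The companion Rota–Baxter operator B̃(g) = g⁻¹ · B(g⁻¹). -/
def tilde {G : Type*} [Group G] (B : G → G) : G → G := fun g => g⁻¹ * B g⁻¹

theorem eq_tilde_inv_mul_inv {G : Type*} [Group G] (B : G → G) (g : G) :
    g = tilde B g⁻¹ * (B g)⁻¹ := by
  simp [tilde]

namespace IsRotaBaxter

variable {G : Type*} [Group G] {B : G → G}

theorem map_one (hB : IsRotaBaxter B) : B 1 = 1 := by
  simpa using hB 1 1

/-- The range of a Rota–Baxter operator is a subgroup. -/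
def range (hB : IsRotaBaxter B) : Subgroup G where
  carrier := Set.range B
  one_mem' := ⟨1, hB.map_one⟩
  mul_mem' := by
    rintro _ _ ⟨g, rfl⟩ ⟨h, rfl⟩
    exact ⟨_, (hB g h).symm⟩
  inv_mem' := by
    rintro _ ⟨g, rfl⟩
    refine ⟨(B g)⁻¹ * g⁻¹ * B g, eq_inv_of_mul_eq_one_right ?_⟩
    rw [hB, show g * B g * ((B g)⁻¹ * g⁻¹ * B g) * (B g)⁻¹ = 1 by group, hB.map_one]

/-- The companion of a Rota–Baxter operator is a Rota–Baxter operator. -/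
theorem companion (hB : IsRotaBaxter B) : IsRotaBaxter (tilde B) := by
  intro g h
  have key := hB g⁻¹ h⁻¹
  have harg : (g * tilde B g * h * (tilde B g)⁻¹)⁻¹ =
      g⁻¹ * B g⁻¹ * h⁻¹ * (B g⁻¹)⁻¹ := by
    simp only [tilde]
    group
  change _ = (g * tilde B g * h * (tilde B g)⁻¹)⁻¹ *
    B (g * tilde B g * h * (tilde B g)⁻¹)⁻¹
  rw [harg, ← key]
  simp only [tilde]
  group

/-- A Rota–Baxter operator whose range meets that of its companion trivially is splitting. -/
theorem isSplitting_of_disjoint_range (hB : IsRotaBaxter B)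
    (hdisj : Disjoint hB.companion.range hB.range) : IsSplitting B := by
  refine ⟨hB.companion.range, hB.range, hdisj.eq_bot, fun g ↦ ?_, fun h hh l hl ↦ ?_⟩
  · exact ⟨_, ⟨g⁻¹, rfl⟩, _, hB.range.inv_mem ⟨g, rfl⟩, eq_tilde_inv_mul_inv B g⟩
  · have hinj := Subgroup.mul_injective_of_disjoint hdisj
    have hmem : B (h * l) ∈ hB.range := ⟨h * l, rfl⟩
    have hmem' : tilde B (h * l)⁻¹ ∈ hB.companion.range := ⟨(h * l)⁻¹, rfl⟩
    have heq := @hinj (⟨h, hh⟩, ⟨l, hl⟩) (⟨_, hmem'⟩, ⟨_, hB.range.inv_mem hmem⟩)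
      (eq_tilde_inv_mul_inv B (h * l))
    have hl' : l = (B (h * l))⁻¹ := congrArg (fun p ↦ (p.2 : G)) heq
    exact (inv_eq_iff_eq_inv.mpr hl').symm

end IsRotaBaxter

/-- For a non-splitting Rota–Baxter operator B on a finite group, R = Im(B) ∩ Im(B̃) is not
contained in ker(B) or not contained in ker(B̃). -/
theorem stmt14 {G : Type*} [Group G] [Finite G] (B : G → G) (hB : IsRotaBaxter B)
    (hns : ¬ IsSplitting B) :
    ¬ (Set.range B ∩ Set.range (tilde B) ⊆ {g : G | B g = 1}) ∨
    ¬ (Set.range B ∩ Set.range (tilde B) ⊆ {g : G | tilde B g = 1}) := by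
  by_contra! hcon
  refine hns (hB.isSplitting_of_disjoint_range (Subgroup.disjoint_def.mpr ?_))
  intro x hx hx'
  have hinv : x⁻¹ ∈ Set.range B ∩ Set.range (tilde B) :=
    ⟨hB.range.inv_mem hx', hB.companion.range.inv_mem hx⟩
  have h₁ : B x⁻¹ = 1 := hcon.1 hinv
  have h₂ : tilde B x = 1 := hcon.2 ⟨hx', hx⟩
  simpa [tilde, h₁] using h₂
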